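/- arXiv:1809.07918 — 2 statements merged into one kernel-verified Lean document; each statement's English description precedes it below -/
import Mathlib

section
/- Let Ω be a quasi-homogeneous convex affine domain in ℝⁿ with n ≥ 1. Then Ω has no bounded face of nonzero dimension: every face of Ω that is a bounded subset of ℝⁿ is a single point. -/
open Matrix Set Filter Topology Pointwise

noncomputable section

/-- The affine action on ℝⁿ of an (n+1)×(n+1) invertible matrix in affine form
(ℝⁿ is identified with the hyperplane x_{n+1} = 1). -/
def affAct (n : ℕ) (g : GL (Fin (n + 1)) ℝ) (x : Fin n → ℝ) : Fin n → ℝ :=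
  fun i => (∑ j : Fin n, g.val i.castSucc j.castSucc * x j) + g.val i.castSucc (Fin.last n)

/-- A matrix in GL(n+1,ℝ) has affine form if its last row is (0, …, 0, 1). -/
def IsAffineForm (n : ℕ) (g : GL (Fin (n + 1)) ℝ) : Prop :=
  (∀ j : Fin n, g.val (Fin.last n) j.castSucc = 0) ∧ g.val (Fin.last n) (Fin.last n) = 1

/-- Aut(Ω): the group (here: set) of affine transformations of ℝⁿ preserving Ω,
realized as affine-form matrices in GL(n+1,ℝ). -/
def AutSet (n : ℕ) (Ω : Set (Fin n → ℝ)) : Set (GL (Fin (n + 1)) ℝ) :=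
  {g | IsAffineForm n g ∧ affAct n g '' Ω = Ω}

/-- Aut⁰(Ω): the identity component of Aut(Ω). -/
def AutIdComp (n : ℕ) (Ω : Set (Fin n → ℝ)) : Set (GL (Fin (n + 1)) ℝ) :=
  connectedComponentIn (AutSet n Ω) 1

/-- The limit set Λ_G of a subset G of Aut(Ω). -/
def limitSet (n : ℕ) (Ω : Set (Fin n → ℝ)) (G : Set (GL (Fin (n + 1)) ℝ)) :
    Set (Fin n → ℝ) :=
  {ξ | ξ ∈ frontier Ω ∧ ∃ x ∈ Ω, ∃ u : ℕ → GL (Fin (n + 1)) ℝ,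
    (∀ k, u k ∈ G) ∧ Filter.Tendsto (fun k => affAct n (u k) x) Filter.atTop (nhds ξ)}

/-- Ω is a convex affine domain: a nonempty open convex subset of ℝⁿ. -/
def IsConvexDomain (n : ℕ) (Ω : Set (Fin n → ℝ)) : Prop :=
  Ω.Nonempty ∧ IsOpen Ω ∧ Convex ℝ Ω

/-- Ω contains no complete affine line. -/
def HasNoLine (n : ℕ) (Ω : Set (Fin n → ℝ)) : Prop :=
  ¬ ∃ x ∈ Ω, ∃ v : Fin n → ℝ, v ≠ 0 ∧ ∀ t : ℝ, x + t • v ∈ Ω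

/-- Ω is a properly convex affine domain. -/
def IsProperlyConvexDomain (n : ℕ) (Ω : Set (Fin n → ℝ)) : Prop :=
  IsConvexDomain n Ω ∧ HasNoLine n Ω

/-- Ω is quasi-homogeneous: some compact K ⊆ Ω has ⋃_{g ∈ Aut(Ω)} g(K) = Ω. -/
def IsQuasiHomogeneous (n : ℕ) (Ω : Set (Fin n → ℝ)) : Prop :=
  ∃ K : Set (Fin n → ℝ), IsCompact K ∧ K ⊆ Ω ∧
    (⋃ g ∈ AutSet n Ω, affAct n g '' K) = Ω

/-- Aut(Ω) is irreducible: it preserves no nonempty proper affine subspace of ℝⁿ. -/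
def IsIrreducibleAut (n : ℕ) (Ω : Set (Fin n → ℝ)) : Prop :=
  ¬ ∃ S : AffineSubspace ℝ (Fin n → ℝ), (S : Set (Fin n → ℝ)).Nonempty ∧
      (S : Set (Fin n → ℝ)) ≠ Set.univ ∧
      ∀ g ∈ AutSet n Ω, affAct n g '' (S : Set (Fin n → ℝ)) = (S : Set (Fin n → ℝ))

/-- The asymptotic cone AC(Ω). -/
def asympCone (n : ℕ) (Ω : Set (Fin n → ℝ)) : Set (Fin n → ℝ) :=
  {u | ∀ x ∈ Ω, ∀ t : ℝ, 0 ≤ t → x + t • u ∈ Ω}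

/-- Ω is a cone with some vertex v. -/
def IsCone (n : ℕ) (Ω : Set (Fin n → ℝ)) : Prop :=
  ∃ v : Fin n → ℝ, ∀ x ∈ Ω, ∀ t : ℝ, 0 < t → v + t • (x - v) ∈ Ω

/-- Two subsets of ℝⁿ are affinely equivalent. -/
def AffinelyEquivalent (n : ℕ) (Ω Ω' : Set (Fin n → ℝ)) : Prop :=
  ∃ e : (Fin n → ℝ) ≃ᵃ[ℝ] (Fin n → ℝ), e '' Ω = Ω'

/-- Γ acts freely on Ω. -/
def ActsFreely (n : ℕ) (Ω : Set (Fin n → ℝ)) (Γ : Set (GL (Fin (n + 1)) ℝ)) : Prop :=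
  ∀ γ ∈ Γ, γ ≠ 1 → ∀ x ∈ Ω, affAct n γ x ≠ x

/-- Γ acts properly discontinuously on Ω. -/
def ActsProperlyDiscontinuously (n : ℕ) (Ω : Set (Fin n → ℝ))
    (Γ : Set (GL (Fin (n + 1)) ℝ)) : Prop :=
  ∀ K L : Set (Fin n → ℝ), K ⊆ Ω → L ⊆ Ω → IsCompact K → IsCompact L →
    {γ ∈ Γ | (affAct n γ '' K ∩ L).Nonempty}.Finite

/-- Γ acts cocompactly on Ω. -/
def ActsCocompactly (n : ℕ) (Ω : Set (Fin n → ℝ)) (Γ : Set (GL (Fin (n + 1)) ℝ)) : Prop :=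
  ∃ K : Set (Fin n → ℝ), IsCompact K ∧ K ⊆ Ω ∧ (⋃ γ ∈ Γ, affAct n γ '' K) = Ω

/-- The linear part of an affine-form matrix has determinant one. -/
def LinearPartDetOne (n : ℕ) (g : GL (Fin (n + 1)) ℝ) : Prop :=
  (Matrix.of fun i j : Fin n => g.val i.castSucc j.castSucc).det = 1

/-- The face relation on the closure of Ω: x ∼ y iff x = y or some open segment inside
the closure of Ω contains both x and y. -/
def FaceRel (n : ℕ) (Ω : Set (Fin n → ℝ)) (x y : Fin n → ℝ) : Prop :=
  x = y ∨ ∃ a b : Fin n → ℝ, openSegment ℝ a b ⊆ closure Ω ∧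
    x ∈ openSegment ℝ a b ∧ y ∈ openSegment ℝ a b

/-- A face of Ω is an equivalence class of the face relation on the closure of Ω. -/
def IsFace (n : ℕ) (Ω F : Set (Fin n → ℝ)) : Prop :=
  ∃ x ∈ closure Ω, F = {y ∈ closure Ω | FaceRel n Ω x y}

/-- A linear map bounded by `c` on the closed ball of radius `r` has norm at most `c / r`. -/
theorem opNorm_le_div_of_closedBall {E F : Type*} [NormedAddCommGroup E] [NormedSpace ℝ E]
    [NormedAddCommGroup F] [NormedSpace ℝ F] {f : E →L[ℝ] F} {r c : ℝ} (hr : 0 < r)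
    (hf : ∀ u, ‖u‖ ≤ r → ‖f u‖ ≤ c) : ‖f‖ ≤ c / r := by
  have hc : 0 ≤ c := (norm_nonneg _).trans (hf 0 (by simpa using hr.le))
  refine ContinuousLinearMap.opNorm_le_of_unit_norm (by positivity) fun u hu => ?_
  have h := hf (r • u) (by rw [norm_smul, hu, Real.norm_of_nonneg hr.le, mul_one])
  rw [map_smul, norm_smul, Real.norm_of_nonneg hr.le] at h
  rwa [le_div_iff₀' hr]

section QuasiHomogeneous

variable {E : Type*} [NormedAddCommGroup E] [NormedSpace ℝ E] [FiniteDimensional ℝ E]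

/-- The functionals of a space of functionals bounded on `S` are bounded on `S` uniformly in terms
of their norms. -/
theorem exists_bound_mul_norm_of_bounded (B : Submodule ℝ (E →L[ℝ] ℝ)) {S : Set E}
    (hB : ∀ f ∈ B, ∃ c, ∀ u ∈ S, |f u| ≤ c) : ∃ C, ∀ f ∈ B, ∀ u ∈ S, |f u| ≤ C * ‖f‖ := by
  obtain ⟨p, hp⟩ := LinearMap.exists_extend (K := ℝ) (V := E →L[ℝ] ℝ) (V' := B) LinearMap.id
  let P : (E →L[ℝ] ℝ) →L[ℝ] (E →L[ℝ] ℝ) := (B.subtype ∘ₗ p).toContinuousLinearMap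
  have hP : ∀ f ∈ B, P f = f := fun f hf =>
    congrArg Subtype.val (LinearMap.congr_fun hp ⟨f, hf⟩)
  obtain ⟨C, hC⟩ := banach_steinhaus
    (g := fun u : S => (ContinuousLinearMap.apply ℝ ℝ (u : E)).comp P) fun f => by
      obtain ⟨c, hc⟩ := hB (P f) (p f).2
      exact ⟨c, fun u => hc u u.2⟩
  refine ⟨C, fun f hf u hu => ?_⟩
  have h := ContinuousLinearMap.le_of_opNorm_le _ (hC ⟨u, hu⟩) f
  rwa [ContinuousLinearMap.comp_apply, hP f hf] at h

/-- A continuous functional that is bounded on `Ω` vanishes if every point of the open set `Ω` can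
be moved into a compact subset of `Ω` by an affine automorphism. -/
theorem functional_eq_zero_of_bounded {Ω K : Set E} (hne : Ω.Nonempty) (hopen : IsOpen Ω)
    (hK : IsCompact K) (hKΩ : K ⊆ Ω)
    (hq : ∀ x ∈ Ω, ∃ y ∈ K, ∃ A : E ≃L[ℝ] E, ∀ u, x + A u ∈ Ω ↔ y + u ∈ Ω)
    (l : E →L[ℝ] ℝ) {M : ℝ} (hl : ∀ z ∈ Ω, |l z| ≤ M) : l = 0 := by
  by_contra hl0
  obtain ⟨v, hv⟩ : ∃ v, l v ≠ 0 := by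
    by_contra! h
    exact hl0 (ContinuousLinearMap.ext h)
  obtain ⟨r, hr, hrΩ⟩ := hK.exists_cthickening_subset_open hopen hKΩ
  let B : Submodule ℝ (E →L[ℝ] ℝ) :=
    { carrier := {f | ∃ c, ∀ z ∈ Ω, |f z| ≤ c}
      zero_mem' := ⟨0, fun z _ => by simp⟩
      add_mem' := by
        rintro f g ⟨c, hc⟩ ⟨d, hd⟩
        exact ⟨c + d, fun z hz => (abs_add_le _ _).trans (add_le_add (hc z hz) (hd z hz))⟩
      smul_mem' := by
        rintro a f ⟨c, hc⟩
        refine ⟨|a| * c, fun z hz => ?_⟩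
        simpa [abs_mul] using mul_le_mul_of_nonneg_left (hc z hz) (abs_nonneg a) }
  obtain ⟨C, hC⟩ := exists_bound_mul_norm_of_bounded B (S := Ω - Ω) (by
    rintro f ⟨c, hc⟩
    refine ⟨c + c, ?_⟩
    rintro _ ⟨z, hz, z', hz', rfl⟩
    simp only [map_sub]
    exact (abs_sub _ _).trans (add_le_add (hc z hz) (hc z' hz')))
  obtain ⟨z₁, hz₁⟩ := hne
  have hlim : Tendsto (fun t : ℝ => z₁ + t • v) (𝓝 0) (𝓝 z₁) := by
    have : Continuous fun t : ℝ => z₁ + t • v := by fun_prop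
    simpa using this.tendsto 0
  obtain ⟨t, ht, ht0⟩ : ∃ t : ℝ, z₁ + t • v ∈ Ω ∧ t ≠ 0 := by
    have h := (hlim.eventually (hopen.mem_nhds hz₁)).filter_mono
      (nhdsWithin_le_nhds : 𝓝[≠] (0 : ℝ) ≤ _)
    obtain ⟨t, h1, h2⟩ := (h.and self_mem_nhdsWithin).exists
    exact ⟨t, h1, h2⟩
  set δ := |l (z₁ + t • v - z₁)| with hδ
  have hδ0 : 0 < δ := by simp [hδ, ht0, hv]
  have hne' : (l '' Ω).Nonempty := ⟨_, mem_image_of_mem _ hz₁⟩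
  have hbdd : BddAbove (l '' Ω) := ⟨M, by
    rintro _ ⟨z, hz, rfl⟩
    exact (le_abs_self _).trans (hl z hz)⟩
  set ε := δ * r / (|C| + 1) with hε
  have hε0 : 0 < ε := by positivity
  obtain ⟨_, ⟨x, hx, rfl⟩, hxs⟩ := exists_lt_of_lt_csSup hne' (sub_lt_self (sSup (l '' Ω)) hε0)
  obtain ⟨y, hy, A, hA⟩ := hq x hx
  set l' : E →L[ℝ] ℝ := l.comp (A : E →L[ℝ] E) with hl'
  have hl'a : ∀ u, l' u = l (A u) := fun u => rfl
  have hball : ∀ u : E, ‖u‖ ≤ r → l' u ≤ ε := by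
    intro u hu
    have h1 : x + A u ∈ Ω := (hA u).2 (hrΩ (by
      apply Metric.mem_cthickening_of_dist_le _ y _ _ hy
      simpa using hu))
    have := le_csSup hbdd (mem_image_of_mem l h1)
    rw [map_add] at this
    rw [hl'a]
    linarith
  have hnorm : ‖l'‖ ≤ ε / r := by
    refine opNorm_le_div_of_closedBall hr fun u hu => ?_
    rw [Real.norm_eq_abs, abs_le']
    exact ⟨hball u hu, by simpa using hball (-u) (by rwa [norm_neg])⟩
  have hmem : l' ∈ B := by
    refine ⟨M + M + |l' y|, fun z hz => ?_⟩
    have h1 : x + A (z - y) ∈ Ω := (hA _).2 (by simpa using hz)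
    have h2 := abs_le.1 (hl _ h1)
    have h3 := abs_le.1 (hl _ hx)
    have h4 := neg_abs_le (l' y)
    have h5 := le_abs_self (l' y)
    rw [map_add, ← hl'a, map_sub] at h2
    exact abs_le.2 ⟨by linarith [h2.1, h3.2], by linarith [h2.2, h3.1]⟩
  have hpull : ∀ z ∈ Ω, y + A.symm (z - x) ∈ Ω := fun z hz => (hA _).1 (by simpa using hz)
  have h1 : |l' ((y + A.symm (z₁ + t • v - x)) - (y + A.symm (z₁ - x)))| ≤ C * ‖l'‖ :=
    hC l' hmem _ (sub_mem_sub (hpull _ ht) (hpull _ hz₁))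
  have h2 : l' ((y + A.symm (z₁ + t • v - x)) - (y + A.symm (z₁ - x))) =
      l (z₁ + t • v - z₁) := by
    rw [hl'a, add_sub_add_left_eq_sub, ← map_sub, A.apply_symm_apply]
    congr 1
    abel
  rw [h2] at h1
  have h3 : δ ≤ |C| * (ε / r) :=
    h1.trans (mul_le_mul (le_abs_self C) hnorm (norm_nonneg _) (abs_nonneg C))
  have h4 : (|C| + 1) * (ε / r) = δ := by rw [hε]; field_simp
  have h5 : 0 < ε / r := by positivity
  linarith

/-- If the chords of a closed convex set `C` centred at one point `x ∈ C` are bounded, then so are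
the chords centred at points of a bounded set. -/
theorem exists_bound_symmetric_chords {C P : Set E} (hC : IsClosed C) (hconv : Convex ℝ C)
    (hP : Bornology.IsBounded P) {x : E} (hx : x ∈ C) {R : ℝ}
    (hR : ∀ w, x + w ∈ C → x - w ∈ C → ‖w‖ ≤ R) :
    ∃ M, ∀ p ∈ P, ∀ q, p + q ∈ C → p - q ∈ C → ‖q‖ ≤ M := by
  by_contra! h
  choose p hpP q hpq hmq hq using fun k : ℕ => h ((k : ℝ) + (|R| + 1))
  have hT : 0 < |R| + 1 := by positivity
  have hk : ∀ k : ℕ, (0 : ℝ) ≤ k := fun k => Nat.cast_nonneg k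
  have hq0 : ∀ k, 0 < ‖q k‖ := fun k => by linarith [hq k, hk k]
  set c : ℕ → ℝ := fun k => (|R| + 1) / ‖q k‖ with hc
  have hc0 : ∀ k, 0 ≤ c k := fun k => by have := hq0 k; simp only [hc]; positivity
  have hc1 : ∀ k, c k ≤ 1 := fun k => by
    simp only [hc]
    rw [div_le_one (hq0 k)]
    linarith [hq k, hk k]
  have hclim : Tendsto c atTop (𝓝 0) := by
    refine Tendsto.div_atTop tendsto_const_nhds ?_
    exact tendsto_atTop_mono (fun k => by linarith [hq k]) tendsto_natCast_atTop_atTop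
  have hsph : ∀ k, c k • q k ∈ Metric.sphere (0 : E) (|R| + 1) := fun k => by
    have := (hq0 k).ne'
    rw [mem_sphere_zero_iff_norm, norm_smul, Real.norm_of_nonneg (hc0 k)]
    simp only [hc]
    field_simp
  obtain ⟨w, hw, φ, hφ, hlim⟩ := (isCompact_sphere (0 : E) (|R| + 1)).tendsto_subseq hsph
  have hsmall : Tendsto (fun k => c k • (p k - x)) atTop (𝓝 0) := by
    obtain ⟨D, hD⟩ := hP.exists_norm_le
    refine hclim.zero_smul_isBoundedUnder_le ?_
    exact isBoundedUnder_of ⟨D + ‖x‖, fun k =>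
      (norm_sub_le _ _).trans (add_le_add_left (hD _ (hpP k)) _)⟩
  have hsmall' := hsmall.comp hφ.tendsto_atTop
  have hplus : x + w ∈ C := by
    have h1 := (tendsto_const_nhds (x := x)).add (hlim.add hsmall')
    rw [add_zero] at h1
    refine hC.mem_of_tendsto h1 (Eventually.of_forall fun k => ?_)
    have := hconv.add_smul_sub_mem hx (hpq (φ k)) ⟨hc0 (φ k), hc1 (φ k)⟩
    convert this using 1
    simp only [Function.comp_apply]
    module
  have hminus : x - w ∈ C := by
    have h1 := (tendsto_const_nhds (x := x)).add (hlim.neg.add hsmall')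
    rw [add_zero, ← sub_eq_add_neg] at h1
    refine hC.mem_of_tendsto h1 (Eventually.of_forall fun k => ?_)
    have := hconv.add_smul_sub_mem hx (hmq (φ k)) ⟨hc0 (φ k), hc1 (φ k)⟩
    convert this using 1
    simp only [Function.comp_apply]
    module
  have := hR w hplus hminus
  rw [mem_sphere_zero_iff_norm] at hw
  linarith [le_abs_self R]

/-- A point of the closure of a quasi-homogeneous convex domain whose face is bounded is extreme. -/
theorem eq_zero_of_bounded_face {Ω K : Set E} (hopen : IsOpen Ω) (hconv : Convex ℝ Ω)
    (hK : IsCompact K) (hKΩ : K ⊆ Ω)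
    (hq : ∀ x ∈ Ω, ∃ y ∈ K, ∃ A : E ≃L[ℝ] E, ∀ u, x + A u ∈ Ω ↔ y + u ∈ Ω)
    {x : E} (hx : x ∈ closure Ω) {R : ℝ}
    (hR : ∀ w, ∀ ε : ℝ, 0 < ε → x + w ∈ closure Ω → x - ε • w ∈ closure Ω → ‖w‖ ≤ R)
    {v : E} (hv : x + v ∈ closure Ω) (hv' : x - v ∈ closure Ω) : v = 0 := by
  obtain ⟨p, hp⟩ := closure_nonempty_iff.1 ⟨x, hx⟩
  obtain ⟨r, hr, hrΩ⟩ := hK.exists_cthickening_subset_open hopen hKΩ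
  have hcomb : ∀ k : ℕ, ∀ z ∈ closure Ω, z + ((k : ℝ) + 1)⁻¹ • (p - z) ∈ Ω := by
    intro k z hz
    have h1 : (0 : ℝ) < ((k : ℝ) + 1)⁻¹ := by positivity
    have h2 : ((k : ℝ) + 1)⁻¹ ≤ 1 := inv_le_one_of_one_le₀ (by simp)
    have := hconv.add_smul_sub_mem_interior' hz (by rwa [hopen.interior_eq]) ⟨h1, h2⟩
    rwa [hopen.interior_eq] at this
  have htlim : Tendsto (fun k : ℕ => ((k : ℝ) + 1)⁻¹) atTop (𝓝 0) := by
    simpa [one_div] using tendsto_one_div_add_atTop_nhds_zero_nat (𝕜 := ℝ)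
  set X : ℕ → E := fun k => x + ((k : ℝ) + 1)⁻¹ • (p - x) with hX
  have hXlim : Tendsto X atTop (𝓝 x) := by
    simpa using tendsto_const_nhds.add (htlim.smul_const (p - x))
  choose y hyK A hA using fun k => hq (X k) (hcomb k x hx)
  obtain ⟨M, hM⟩ := exists_bound_symmetric_chords isClosed_closure hconv.closure
    ((Metric.isBounded_range_of_tendsto X hXlim).union hK.isBounded) hx
    (fun w h1 h2 => hR w 1 one_pos h1 (by simpa using h2))
  have hM0 : 0 ≤ M := (norm_nonneg _).trans (hM (X 0) (Or.inl ⟨0, rfl⟩) 0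
    (by simpa only [add_zero, sub_zero] using subset_closure (hcomb 0 x hx))
    (by simpa only [add_zero, sub_zero] using subset_closure (hcomb 0 x hx)))
  have hAbd : ∀ k, ‖(A k : E →L[ℝ] E)‖ ≤ M / r := by
    intro k
    have hmem : ∀ u : E, ‖u‖ ≤ r → X k + A k u ∈ closure Ω := fun u hu =>
      subset_closure ((hA k u).2 (hrΩ (by
        apply Metric.mem_cthickening_of_dist_le _ (y k) _ _ (hyK k)
        simpa using hu)))
    refine opNorm_le_div_of_closedBall hr fun u hu => ?_
    refine hM (X k) (Or.inl ⟨k, rfl⟩) _ (hmem u hu) ?_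
    have := hmem (-u) (by rwa [norm_neg])
    rwa [map_neg, ← sub_eq_add_neg] at this
  set W : ℕ → E := fun k => (A k).symm ((1 - ((k : ℝ) + 1)⁻¹) • v) with hW
  have hAW : ∀ k, A k (W k) = (1 - ((k : ℝ) + 1)⁻¹) • v := fun k => (A k).apply_symm_apply _
  have hWbd : ∀ k, ‖W k‖ ≤ M := by
    intro k
    refine hM (y k) (Or.inr (hyK k)) (W k) (subset_closure ((hA k _).1 ?_))
      (subset_closure ?_)
    · rw [hAW]
      convert hcomb k _ hv using 1
      simp only [hX]
      module
    · rw [sub_eq_add_neg]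
      refine (hA k _).1 ?_
      rw [map_neg, hAW]
      convert hcomb k _ hv' using 1
      simp only [hX]
      module
  obtain ⟨y₀, hy₀, φ, hφ, hylim⟩ := hK.tendsto_subseq hyK
  obtain ⟨⟨A₀, w⟩, -, ψ, hψ, hlim⟩ := tendsto_subseq_of_bounded
    (x := fun k => (((A (φ k) : E ≃L[ℝ] E) : E →L[ℝ] E), W (φ k)))
    ((Metric.isBounded_closedBall (x := (0 : E →L[ℝ] E)) (r := M / r)).prod
      (Metric.isBounded_closedBall (x := (0 : E)) (r := M)))
    (fun k => ⟨by simpa using hAbd (φ k), by simpa using hWbd (φ k)⟩)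
  have hAlim := (continuous_fst.tendsto _).comp hlim
  have hsub := hφ.tendsto_atTop.comp hψ.tendsto_atTop
  have happly : ∀ u : E,
      Tendsto (fun q : (E →L[ℝ] E) × E => q.1 q.2) (𝓝 (A₀, u)) (𝓝 (A₀ u)) :=
    fun _ => isBoundedBilinearMap_apply.continuous.continuousAt
  have hA₀w : A₀ w = v := by
    have h1 := (happly _).comp hlim
    have h2 : Tendsto (fun k : ℕ => (1 - ((k : ℝ) + 1)⁻¹) • v) atTop (𝓝 v) := by
      simpa using (htlim.const_sub 1).smul_const v
    refine tendsto_nhds_unique h1 ((h2.comp hsub).congr fun k => ?_)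
    simp only [Function.comp_apply]
    exact (hAW _).symm
  have hA₀mem : ∀ z ∈ Ω, x + A₀ (z - y₀) ∈ closure Ω := by
    intro z hz
    have h1 := (hXlim.comp hsub).add
      ((happly _).comp (hAlim.prodMk_nhds
        ((tendsto_const_nhds (x := z)).sub (hylim.comp hψ.tendsto_atTop))))
    refine isClosed_closure.mem_of_tendsto h1 (Eventually.of_forall fun k =>
      subset_closure ((hA _ _).2 ?_))
    simpa using hz
  have hbd : ∀ z ∈ Ω, ‖A₀ (z - y₀)‖ ≤ R := by
    intro z hz
    have hcont : Tendsto (fun ε : ℝ => y₀ - ε • (z - y₀)) (𝓝 0) (𝓝 y₀) := by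
      have : Continuous fun ε : ℝ => y₀ - ε • (z - y₀) := by fun_prop
      simpa using this.tendsto 0
    have h := (hcont.eventually (hopen.mem_nhds (hKΩ hy₀))).filter_mono
      (nhdsWithin_le_nhds : 𝓝[>] (0 : ℝ) ≤ _)
    obtain ⟨ε, h1, h2⟩ := (h.and self_mem_nhdsWithin).exists
    refine hR _ ε h2 (hA₀mem z hz) ?_
    have h3 := hA₀mem _ h1
    rwa [sub_sub_cancel_left, map_neg, map_smul, ← sub_eq_add_neg] at h3
  by_contra hv0
  obtain ⟨l, -, hl⟩ := exists_dual_vector ℝ v (norm_ne_zero_iff.2 hv0)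
  have h0 : l.comp A₀ = 0 := by
    refine functional_eq_zero_of_bounded ⟨p, hp⟩ hopen hK hKΩ hq _
      (M := ‖l‖ * (R + ‖A₀ y₀‖)) fun z hz => ?_
    refine (l.le_opNorm _).trans (mul_le_mul_of_nonneg_left ?_ (norm_nonneg _))
    have h1 := norm_add_le (A₀ (z - y₀)) (A₀ y₀)
    rw [← map_add, sub_add_cancel] at h1
    exact h1.trans (by gcongr; exact hbd z hz)
  have h1 := congrArg (fun f : E →L[ℝ] ℝ => f w) h0
  simp only [ContinuousLinearMap.comp_apply, hA₀w, hl] at h1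
  exact hv0 (by simpa using h1)

end QuasiHomogeneous

/-- An affine-form matrix acts by an affine map whose linear part is invertible. -/
theorem exists_linearEquiv_affAct {n : ℕ} {g : GL (Fin (n + 1)) ℝ} (hg : IsAffineForm n g) :
    ∃ A : (Fin n → ℝ) ≃L[ℝ] (Fin n → ℝ), ∀ y u, affAct n g (y + u) = affAct n g y + A u := by
  let L : (Fin n → ℝ) →ₗ[ℝ] (Fin n → ℝ) :=
    Matrix.toLin' (Matrix.of fun i j : Fin n => g.val i.castSucc j.castSucc)
  have hL : ∀ u i, L u i = ∑ j : Fin n, g.val i.castSucc j.castSucc * u j := fun u i => rfl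
  have hinj : Function.Injective L := by
    rw [← LinearMap.ker_eq_bot, LinearMap.ker_eq_bot']
    intro u hu
    have h0 : g.val *ᵥ (Fin.snoc u 0 : Fin (n + 1) → ℝ) = 0 := by
      ext i
      rw [Matrix.mulVec, dotProduct, Fin.sum_univ_castSucc]
      simp only [Fin.snoc_castSucc, Fin.snoc_last, mul_zero, add_zero, Pi.zero_apply]
      refine Fin.lastCases ?_ (fun i => ?_) i
      · simp [hg.1]
      · rw [← hL, hu, Pi.zero_apply]
    have h1 : (Fin.snoc u 0 : Fin (n + 1) → ℝ) = 0 := by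
      apply Matrix.mulVec_injective_of_isUnit g.isUnit
      rw [h0, Matrix.mulVec_zero]
    ext i
    simpa using congrFun h1 i.castSucc
  refine ⟨(LinearEquiv.ofInjectiveEndo L hinj).toContinuousLinearEquiv, fun y u => ?_⟩
  ext i
  have : (LinearEquiv.ofInjectiveEndo L hinj).toContinuousLinearEquiv u = L u := rfl
  rw [Pi.add_apply, this, hL]
  simp only [affAct, Pi.add_apply, mul_add, Finset.sum_add_distrib]
  ring

/-- a quasi-homogeneous convex affine domain has no bounded face of
nonzero dimension: every bounded face is a single point. -/
theorem bounded_face_is_point (n : ℕ) (hn : 1 ≤ n) (Ω : Set (Fin n → ℝ))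
    (hdom : IsConvexDomain n Ω) (h2 : IsQuasiHomogeneous n Ω) :
    ∀ F : Set (Fin n → ℝ), IsFace n Ω F → Bornology.IsBounded F →
      ∃ p : Fin n → ℝ, F = {p} := by
  rintro F ⟨x, hx, rfl⟩ hF
  obtain ⟨-, hopen, hconv⟩ := hdom
  obtain ⟨K, hK, hKΩ, hcov⟩ := h2
  have hq : ∀ x ∈ Ω, ∃ y ∈ K, ∃ A : (Fin n → ℝ) ≃L[ℝ] (Fin n → ℝ),
      ∀ u, x + A u ∈ Ω ↔ y + u ∈ Ω := by
    intro x hx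
    rw [← hcov] at hx
    simp only [mem_iUnion] at hx
    obtain ⟨g, ⟨hg, hgΩ⟩, y, hy, rfl⟩ := hx
    obtain ⟨A, hA⟩ := exists_linearEquiv_affAct hg
    refine ⟨y, hy, A, fun u => ?_⟩
    rw [← hA]
    constructor
    · intro h
      rw [← hgΩ] at h
      obtain ⟨z, hz, hzu⟩ := h
      have h1 : z = y + (z - y) := by abel
      rw [h1, hA, hA, add_right_inj] at hzu
      rw [← A.injective hzu]
      simpa using hz
    · intro h
      rw [← hgΩ]
      exact mem_image_of_mem _ h
  obtain ⟨R, hR⟩ := hF.exists_norm_le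
  refine ⟨x, Subset.antisymm ?_ ?_⟩
  · rintro y ⟨-, rfl | ⟨a, b, hab, ⟨s, t, hs, ht, hst, hxab⟩, hyab⟩⟩
    · rfl
    have key : ∀ c : ℝ, |c| < s → |c| < t → x + c • (b - a) ∈ closure Ω := by
      intro c h1 h2
      rw [abs_lt] at h1 h2
      refine hab ⟨s - c, t + c, by linarith, by linarith, by linarith, ?_⟩
      rw [← hxab]
      module
    have hm : 0 < min s t / 2 := by positivity
    have hms : |min s t / 2| < s := by
      rw [abs_of_pos hm]; linarith [min_le_left s t]
    have hmt : |min s t / 2| < t := by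
      rw [abs_of_pos hm]; linarith [min_le_right s t]
    have hv : (min s t / 2) • (b - a) = 0 := by
      refine eq_zero_of_bounded_face hopen hconv hK hKΩ hq hx (R := 2 * (R + ‖x‖)) ?_
        (key _ hms hmt) ?_
      · intro w ε hε h1 h2
        have h3 : x + (1 / 2 : ℝ) • w ∈ {y ∈ closure Ω | FaceRel n Ω x y} := by
          refine ⟨?_, Or.inr ⟨x - ε • w, x + w, ?_, ?_, ?_⟩⟩
          · have := hconv.closure.add_smul_mem hx h1 (t := 1 / 2) ⟨by norm_num, by norm_num⟩
            exact this
          · exact hconv.closure.openSegment_subset h2 h1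
          · refine ⟨1 / (1 + ε), ε / (1 + ε), by positivity, by positivity, by field_simp, ?_⟩
            have : (1 / (1 + ε)) • (x - ε • w) + (ε / (1 + ε)) • (x + w) =
              ((1 / (1 + ε)) * (1 + ε)) • x := by module
            rw [this, one_div_mul_cancel (by positivity), one_smul]
          · refine ⟨1 / 2 / (1 + ε), (1 / 2 + ε) / (1 + ε), by positivity, by positivity,
              by field_simp; ring, ?_⟩
            have : (1 / 2 / (1 + ε)) • (x - ε • w) + ((1 / 2 + ε) / (1 + ε)) • (x + w) =
              ((1 / (1 + ε)) * (1 + ε)) • (x + (1 / 2 : ℝ) • w) := by module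
            rw [this, one_div_mul_cancel (by positivity), one_smul]
        have h4 := norm_sub_le (x + (1 / 2 : ℝ) • w) x
        rw [add_sub_cancel_left, norm_smul, Real.norm_of_nonneg (by norm_num)] at h4
        linarith [hR _ h3]
      · have := key (-(min s t / 2)) (by rwa [abs_neg]) (by rwa [abs_neg])
        rwa [neg_smul, ← sub_eq_add_neg] at this
    have hba : a = b := ((sub_eq_zero.1 ((smul_eq_zero.1 hv).resolve_left hm.ne'))).symm
    subst hba
    rw [openSegment_same] at hyab
    rw [hyab, ← hxab, ← add_smul, hst, one_smul]
    rfl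
  · rintro _ rfl
    exact ⟨hx, Or.inl rfl⟩
end
end

section
/- Every divisible properly convex affine domain is a cone: if Ω is a properly convex affine domain in ℝⁿ and there exists a discrete subgroup Γ of Aut(Ω) acting freely and properly discontinuously on Ω with compact quotient (there is a compact set K ⊆ Ω with ⋃_{γ∈Γ} γ(K) = Ω), then there exists v ∈ ℝⁿ such that v + t•(x − v) ∈ Ω for all x ∈ Ω and all t > 0. -/
open Matrix Set Filter Topology Pointwise

noncomputable section

open MeasureTheory
open scoped ENNReal

/-! ### Mass transport for a countable group action -/

/-- Two weights whose sums over every orbit are `1` have the same integral over an invariant set. -/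
theorem setLIntegral_eq_of_tsum_orbit_eq_one {G Z : Type*} [Group G] [Countable G]
    [MeasurableSpace Z] {μ : Measure Z} {T : G → Z → Z} (hT : ∀ g, MeasurePreserving (T g) μ μ)
    (hinv : ∀ g z, T g⁻¹ (T g z) = z) {U : Set Z} (hU : MeasurableSet U)
    (hTU : ∀ g z, T g z ∈ U ↔ z ∈ U) {v w : Z → ℝ≥0∞} (hv : Measurable v) (hw : Measurable w)
    (hv1 : ∀ z ∈ U, ∑' g, v (T g z) = 1) (hw1 : ∀ z ∈ U, ∑' g, w (T g z) = 1) :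
    ∫⁻ z in U, v z ∂μ = ∫⁻ z in U, w z ∂μ := by
  have key : ∀ g, ∫⁻ z, U.indicator (fun z => v z * w (T g z)) z ∂μ
      = ∫⁻ z, U.indicator (fun z => v (T g⁻¹ z) * w z) z ∂μ := by
    intro g
    have hm : Measurable (U.indicator (fun z => v (T g⁻¹ z) * w z)) :=
      ((hv.comp (hT _).measurable).mul hw).indicator hU
    rw [← (hT g).lintegral_comp hm]
    refine lintegral_congr fun z => ?_
    by_cases hz : z ∈ U
    · rw [indicator_of_mem hz, indicator_of_mem ((hTU g z).2 hz), hinv]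
    · rw [indicator_of_notMem hz, indicator_of_notMem (fun h => hz ((hTU g z).1 h))]
  calc ∫⁻ z in U, v z ∂μ
      = ∫⁻ z in U, ∑' g, v z * w (T g z) ∂μ := by
        refine setLIntegral_congr_fun hU fun z hz => ?_
        simp only [ENNReal.tsum_mul_left, hw1 z hz, mul_one]
    _ = ∑' g, ∫⁻ z in U, v z * w (T g z) ∂μ :=
        lintegral_tsum fun g => (hv.mul (hw.comp (hT g).measurable)).aemeasurable
    _ = ∑' g, ∫⁻ z in U, v (T g⁻¹ z) * w z ∂μ := by
        refine tsum_congr fun g => ?_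
        rw [← lintegral_indicator hU, key, lintegral_indicator hU]
    _ = ∑' g, ∫⁻ z in U, v (T g z) * w z ∂μ :=
        (Equiv.inv G).tsum_eq (fun g => ∫⁻ z in U, v (T g z) * w z ∂μ)
    _ = ∫⁻ z in U, ∑' g, v (T g z) * w z ∂μ :=
        (lintegral_tsum fun g => ((hv.comp (hT g).measurable).mul hw).aemeasurable).symm
    _ = ∫⁻ z in U, w z ∂μ := by
        refine setLIntegral_congr_fun hU fun z hz => ?_
        simp only [ENNReal.tsum_mul_right, hv1 z hz, one_mul]

/-- Fubini for a weight depending on the first variable. -/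
theorem setLIntegral_prod_fst {X Y : Type*} [MeasurableSpace X] [MeasurableSpace Y]
    {μ : Measure X} {ν : Measure Y} [SFinite μ] [SFinite ν] {U : Set (X × Y)}
    (hU : MeasurableSet U) {w : X → ℝ≥0∞} (hw : Measurable w) :
    ∫⁻ z in U, w z.1 ∂(μ.prod ν) = ∫⁻ x, w x * ν {y | (x, y) ∈ U} ∂μ := by
  rw [← lintegral_indicator hU,
    lintegral_prod (U.indicator fun z => w z.1)
      ((hw.comp measurable_fst).indicator hU).aemeasurable]
  refine lintegral_congr fun x => ?_
  have hx : MeasurableSet {y | (x, y) ∈ U} := measurable_prodMk_left hU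
  rw [← setLIntegral_const, ← lintegral_indicator hx]
  rfl

/-- Fubini for a weight depending on the second variable. -/
theorem setLIntegral_prod_snd {X Y : Type*} [MeasurableSpace X] [MeasurableSpace Y]
    {μ : Measure X} {ν : Measure Y} [SFinite μ] [SFinite ν] {U : Set (X × Y)}
    (hU : MeasurableSet U) {w : Y → ℝ≥0∞} (hw : Measurable w) :
    ∫⁻ z in U, w z.2 ∂(μ.prod ν) = ∫⁻ y, w y * μ {x | (x, y) ∈ U} ∂ν := by
  rw [← lintegral_indicator hU,
    lintegral_prod_symm (U.indicator fun z => w z.2)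
      ((hw.comp measurable_snd).indicator hU).aemeasurable]
  refine lintegral_congr fun y => ?_
  have hy : MeasurableSet {x | (x, y) ∈ U} := measurable_prodMk_right hU
  rw [← setLIntegral_const, ← lintegral_indicator hy]
  rfl

/-! ### Caps of a convex domain -/

/-- The interior of the cone of linear forms that are bounded above on `Ω`. -/
def boundedForms {n : ℕ} (Ω : Set (Fin n → ℝ)) : Set (Fin n → ℝ) :=
  interior {p | ∃ C : ℝ, ∀ z ∈ Ω, p ⬝ᵥ z ≤ C}

/-- The pairs `(x, p)` such that `x` lies in the cap of depth `r` cut out of `Ω` by the linear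
form `p`. -/
def capPairs {n : ℕ} (Ω : Set (Fin n → ℝ)) (r : ℝ) : Set ((Fin n → ℝ) × (Fin n → ℝ)) :=
  {q | q.1 ∈ Ω ∧ q.2 ∈ boundedForms Ω ∧ ∀ z ∈ Ω, q.2 ⬝ᵥ z ≤ q.2 ⬝ᵥ q.1 + r}

/-- The volume of the cap of depth `r` cut out of `Ω` by the linear form `p`. -/
def capVolume {n : ℕ} (Ω : Set (Fin n → ℝ)) (r : ℝ) (p : Fin n → ℝ) : ℝ≥0∞ :=
  volume {x | (x, p) ∈ capPairs Ω r}

theorem isOpen_boundedForms {n : ℕ} (Ω : Set (Fin n → ℝ)) : IsOpen (boundedForms Ω) :=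
  isOpen_interior

theorem measurableSet_capPairs {n : ℕ} {Ω : Set (Fin n → ℝ)} (hΩ : IsOpen Ω) (r : ℝ) :
    MeasurableSet (capPairs Ω r) := by
  have h : IsClosed {q : (Fin n → ℝ) × (Fin n → ℝ) | ∀ z ∈ Ω, q.2 ⬝ᵥ z ≤ q.2 ⬝ᵥ q.1 + r} := by
    simp only [ofPred_forall]
    refine isClosed_biInter fun z _ => isClosed_le (by fun_prop) (by fun_prop)
  exact (hΩ.preimage continuous_fst).measurableSet.inter
    (((isOpen_boundedForms Ω).preimage continuous_snd).measurableSet.inter h.measurableSet)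

theorem measurable_capVolume {n : ℕ} {Ω : Set (Fin n → ℝ)} (hΩ : IsOpen Ω) (r : ℝ) :
    Measurable (capVolume Ω r) :=
  measurable_measure_prodMk_right (measurableSet_capPairs hΩ r)

/-- If `Ω` contains no line, some open set of linear forms is bounded above on `Ω`. -/
theorem boundedForms_nonempty {n : ℕ} {Ω : Set (Fin n → ℝ)} (h : IsProperlyConvexDomain n Ω) :
    (boundedForms Ω).Nonempty := by
  obtain ⟨⟨⟨x, hx⟩, ho, hc⟩, hl⟩ := h
  set D : Set (Fin n → ℝ) := {p | ∃ C : ℝ, ∀ z ∈ Ω, p ⬝ᵥ z ≤ C}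
  have hDc : Convex ℝ D := by
    rintro p ⟨C, hC⟩ q ⟨C', hC'⟩ a b ha hb -
    refine ⟨a * C + b * C', fun z hz => ?_⟩
    rw [add_dotProduct, smul_dotProduct, smul_dotProduct, smul_eq_mul, smul_eq_mul]
    exact add_le_add (mul_le_mul_of_nonneg_left (hC z hz) ha)
      (mul_le_mul_of_nonneg_left (hC' z hz) hb)
  change (interior D).Nonempty
  rw [hDc.interior_nonempty_iff_affineSpan_eq_top]
  by_contra hne
  have h0 : (0 : Fin n → ℝ) ∈ D := ⟨0, fun z _ => by simp⟩
  have hspan : Submodule.span ℝ D < ⊤ := by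
    refine lt_top_iff_ne_top.2 fun htop => hne (SetLike.coe_injective ?_)
    rw [← insert_eq_of_mem h0, affineSpan_insert_zero, htop]
    rfl
  obtain ⟨f, hf0, hf⟩ := Submodule.exists_le_ker_of_lt_top _ hspan
  set v : Fin n → ℝ := fun i => f (Pi.single i 1) with hv
  have hfv : ∀ p, f p = p ⬝ᵥ v := fun p => by
    rw [LinearMap.pi_apply_eq_sum_univ f p]
    simp only [dotProduct, smul_eq_mul, hv]
    refine Finset.sum_congr rfl fun i _ => ?_
    congr 2
    ext j
    simp [Pi.single_apply, eq_comm]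
  refine hl ⟨x, hx, v, fun hv0 => hf0 (LinearMap.ext fun p => by simp [hfv, hv0]), fun t => ?_⟩
  by_contra hxt
  obtain ⟨g, hg⟩ := geometric_hahn_banach_open_point hc ho hxt
  set p : Fin n → ℝ := fun i => g (Pi.single i 1) with hp
  have hgp : ∀ z, g z = p ⬝ᵥ z := fun z => by
    have := LinearMap.pi_apply_eq_sum_univ (g : (Fin n → ℝ) →ₗ[ℝ] ℝ) z
    rw [ContinuousLinearMap.coe_coe] at this
    rw [this]
    simp only [dotProduct, smul_eq_mul, hp]
    refine Finset.sum_congr rfl fun i _ => ?_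
    rw [mul_comm]
    congr 2
    ext j
    simp [Pi.single_apply, eq_comm]
  have hpD : p ∈ D := ⟨g (x + t • v), fun z hz => by rw [← hgp]; exact (hg z hz).le⟩
  have hpv : p ⬝ᵥ v = 0 := by rw [← hfv]; exact hf (Submodule.subset_span hpD)
  have := hg x hx
  rw [hgp, hgp, dotProduct_add, dotProduct_smul, hpv, smul_zero, add_zero] at this
  exact lt_irrefl _ this

/-- The cap as a slice of `Ω` below a supporting point. -/
theorem mem_capPairs_iff {n : ℕ} {Ω : Set (Fin n → ℝ)} {p z₀ : Fin n → ℝ}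
    (hp : p ∈ boundedForms Ω) (hz₀ : z₀ ∈ closure Ω) (hmax : ∀ z ∈ Ω, p ⬝ᵥ z ≤ p ⬝ᵥ z₀) {r : ℝ}
    {x : Fin n → ℝ} : (x, p) ∈ capPairs Ω r ↔ x ∈ Ω ∧ p ⬝ᵥ z₀ ≤ p ⬝ᵥ x + r := by
  refine ⟨fun h => ⟨h.1, ?_⟩, fun h => ⟨h.1, hp, fun z hz => (hmax z hz).trans h.2⟩⟩
  have hcl : IsClosed {z : Fin n → ℝ | p ⬝ᵥ z ≤ p ⬝ᵥ x + r} :=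
    isClosed_le (by fun_prop) (by fun_prop)
  exact closure_minimal h.2.2 hcl hz₀

theorem isBounded_cap {n : ℕ} {Ω : Set (Fin n → ℝ)} {p : Fin n → ℝ}
    (hp : p ∈ boundedForms Ω) (r : ℝ) : Bornology.IsBounded {x | (x, p) ∈ capPairs Ω r} := by
  obtain ⟨ε, hε, hball⟩ := Metric.isOpen_iff.1 (isOpen_boundedForms Ω) p hp
  have hmem : ∀ i (s : ℝ), |s| < ε → ∃ C, ∀ z ∈ Ω, (p + Pi.single i s) ⬝ᵥ z ≤ C := by
    intro i s hs
    have hsub : boundedForms Ω ⊆ {p | ∃ C : ℝ, ∀ z ∈ Ω, p ⬝ᵥ z ≤ C} := interior_subset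
    refine hsub (hball ?_)
    rw [Metric.mem_ball, dist_eq_norm, add_sub_cancel_left, Pi.norm_single]
    exact hs
  rcases {x | (x, p) ∈ capPairs Ω r}.eq_empty_or_nonempty with he | ⟨y, hy⟩
  · rw [he]; exact Bornology.isBounded_empty
  have hε2 : |ε / 2| < ε := by rw [abs_of_pos (by positivity)]; linarith
  choose C hC using fun i => hmem i (ε / 2) hε2
  choose C' hC' using fun i => hmem i (-(ε / 2)) (by rwa [abs_neg])
  refine (Metric.isBounded_Icc
    (fun i => -((C' i - p ⬝ᵥ y + r) / (ε / 2))) (fun i => (C i - p ⬝ᵥ y + r) / (ε / 2))).subset ?_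
  intro x hx
  have hyx := hx.2.2 y hy.1
  simp only at hyx
  refine ⟨fun i => ?_, fun i => ?_⟩
  · have := hC' i x hx.1
    rw [add_dotProduct, single_dotProduct] at this
    rw [neg_le, le_div_iff₀ (by positivity)]
    linarith
  · have := hC i x hx.1
    rw [add_dotProduct, single_dotProduct] at this
    rw [le_div_iff₀ (by positivity)]
    linarith

theorem capVolume_lt_top {n : ℕ} {Ω : Set (Fin n → ℝ)} {p : Fin n → ℝ}
    (hp : p ∈ boundedForms Ω) (r : ℝ) : capVolume Ω r p < ∞ :=
  (isBounded_cap hp r).measure_lt_top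

theorem exists_supporting_point {n : ℕ} {Ω : Set (Fin n → ℝ)} (hne : Ω.Nonempty)
    {p : Fin n → ℝ} (hp : p ∈ boundedForms Ω) :
    ∃ z₀ ∈ closure Ω, ∀ z ∈ Ω, p ⬝ᵥ z ≤ p ⬝ᵥ z₀ := by
  obtain ⟨C, hC⟩ := interior_subset hp
  obtain ⟨x, hx⟩ := hne
  set r := C - p ⬝ᵥ x
  have hxr : (x, p) ∈ capPairs Ω r := ⟨hx, hp, fun z hz => by simpa [r] using hC z hz⟩
  obtain ⟨z₀, hz₀, hmax⟩ := (isBounded_cap hp r).isCompact_closure.exists_isMaxOn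
    ⟨x, subset_closure hxr⟩ (f := fun z => p ⬝ᵥ z) (by fun_prop)
  refine ⟨z₀, closure_mono (fun y hy => hy.1) hz₀, fun z hz => ?_⟩
  by_cases hzr : (z, p) ∈ capPairs Ω r
  · exact hmax (subset_closure hzr)
  · have : ¬ ∀ y ∈ Ω, p ⬝ᵥ y ≤ p ⬝ᵥ z + r := fun h => hzr ⟨hz, hp, h⟩
    push Not at this
    obtain ⟨y, hy, hyz⟩ := this
    have h1 : p ⬝ᵥ x ≤ p ⬝ᵥ z₀ := hmax (subset_closure hxr)
    have h2 := hC y hy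
    simp only [r] at hyz
    linarith

theorem capVolume_pos {n : ℕ} {Ω : Set (Fin n → ℝ)} (hne : Ω.Nonempty) (ho : IsOpen Ω)
    {p : Fin n → ℝ} (hp : p ∈ boundedForms Ω) {r : ℝ} (hr : 0 < r) : 0 < capVolume Ω r p := by
  obtain ⟨z₀, hz₀, hmax⟩ := exists_supporting_point hne hp
  have hO : IsOpen {x : Fin n → ℝ | p ⬝ᵥ z₀ < p ⬝ᵥ x + r} := isOpen_lt (by fun_prop) (by fun_prop)
  obtain ⟨x, hx, hxΩ⟩ := mem_closure_iff.1 hz₀ _ hO (by simpa using hr)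
  refine ((hO.inter ho).measure_pos volume ⟨x, hx, hxΩ⟩).trans_le (measure_mono fun y hy => ?_)
  exact (mem_capPairs_iff hp hz₀ hmax).2 ⟨hy.2, hy.1.le⟩

theorem homothety_mem {n : ℕ} {Ω : Set (Fin n → ℝ)} (ho : IsOpen Ω) (hc : Convex ℝ Ω)
    {z₀ x : Fin n → ℝ} (hz₀ : z₀ ∈ closure Ω) (hx : x ∈ Ω) {t : ℝ} (ht : 0 < t) (ht1 : t ≤ 1) :
    z₀ + t • (x - z₀) ∈ Ω := by
  have := hc.combo_interior_closure_mem_interior (ho.interior_eq.symm ▸ hx) hz₀ ht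
    (sub_nonneg.2 ht1) (by ring)
  rw [ho.interior_eq] at this
  convert this using 1
  module

/-- Contracting a deep cap towards its supporting point gives a subset of a shallow one. -/
theorem homothety_image_cap_subset {n : ℕ} {Ω : Set (Fin n → ℝ)} (ho : IsOpen Ω)
    (hc : Convex ℝ Ω) {p z₀ : Fin n → ℝ} (hp : p ∈ boundedForms Ω) (hz₀ : z₀ ∈ closure Ω)
    (hmax : ∀ z ∈ Ω, p ⬝ᵥ z ≤ p ⬝ᵥ z₀) {r t : ℝ} (ht : 0 < t) (ht1 : t ≤ 1) :
    AffineMap.homothety z₀ t '' {x | (x, p) ∈ capPairs Ω r} ⊆ {x | (x, p) ∈ capPairs Ω (t * r)} := by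
  rintro _ ⟨x, hx, rfl⟩
  obtain ⟨hxΩ, hxr⟩ := (mem_capPairs_iff hp hz₀ hmax).1 hx
  have heq : AffineMap.homothety z₀ t x = z₀ + t • (x - z₀) := by
    simp [AffineMap.homothety_apply, add_comm]
  refine (mem_capPairs_iff hp hz₀ hmax).2 ⟨heq ▸ homothety_mem ho hc hz₀ hxΩ ht ht1, ?_⟩
  rw [heq, dotProduct_add, dotProduct_smul, dotProduct_sub, smul_eq_mul]
  nlinarith

theorem capVolume_homothety_image {n : ℕ} (Ω : Set (Fin n → ℝ)) (p z₀ : Fin n → ℝ) (r : ℝ)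
    {t : ℝ} (ht : 0 < t) : volume (AffineMap.homothety z₀ t '' {x | (x, p) ∈ capPairs Ω r})
      = ENNReal.ofReal (t ^ n) * capVolume Ω r p := by
  rw [Measure.addHaar_image_homothety, Module.finrank_fin_fun, abs_of_pos (by positivity)]
  rfl

theorem capVolume_natCast_mul_le {n : ℕ} {Ω : Set (Fin n → ℝ)} (hne : Ω.Nonempty) (ho : IsOpen Ω)
    (hc : Convex ℝ Ω) {p : Fin n → ℝ} (hp : p ∈ boundedForms Ω) {m : ℕ} (hm : 0 < m) :
    capVolume Ω m p ≤ ENNReal.ofReal ((m : ℝ) ^ n) * capVolume Ω 1 p := by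
  obtain ⟨z₀, hz₀, hmax⟩ := exists_supporting_point hne hp
  have hm0 : (0 : ℝ) < m := by exact_mod_cast hm
  have hm1 : (m : ℝ)⁻¹ ≤ 1 := inv_le_one_of_one_le₀ (by exact_mod_cast hm)
  have h := measure_mono (μ := volume)
    (homothety_image_cap_subset (r := m) ho hc hp hz₀ hmax (inv_pos.2 hm0) hm1)
  rw [capVolume_homothety_image _ _ _ _ (inv_pos.2 hm0), inv_mul_cancel₀ hm0.ne'] at h
  calc capVolume Ω m p
      = ENNReal.ofReal ((m : ℝ) ^ n) * (ENNReal.ofReal ((m : ℝ)⁻¹ ^ n) * capVolume Ω m p) := by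
        rw [← mul_assoc, ← ENNReal.ofReal_mul (by positivity), ← mul_pow,
          mul_inv_cancel₀ hm0.ne', one_pow, ENNReal.ofReal_one, one_mul]
    _ ≤ _ := by gcongr; exact h

/-- If the cap volumes cut out by one linear form scale like those of a cone, then `Ω` is a
cone. -/
theorem isCone_of_capVolume_eq {n : ℕ} {Ω : Set (Fin n → ℝ)} (hne : Ω.Nonempty) (ho : IsOpen Ω)
    (hc : Convex ℝ Ω) {p : Fin n → ℝ} (hp : p ∈ boundedForms Ω)
    (hvol : ∀ m : ℕ, 0 < m →
      capVolume Ω m p = ENNReal.ofReal ((m : ℝ) ^ n) * capVolume Ω 1 p) : IsCone n Ω := by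
  obtain ⟨z₀, hz₀, hmax⟩ := exists_supporting_point hne hp
  refine ⟨z₀, fun x hx t ht => ?_⟩
  obtain ⟨k, hk⟩ := exists_nat_ge (max t 1)
  obtain ⟨m, hm⟩ := exists_nat_gt (p ⬝ᵥ z₀ - p ⬝ᵥ x)
  have hk1 : (1 : ℝ) ≤ k := (le_max_right _ _).trans hk
  have hk0 : (0 : ℝ) < k := one_pos.trans_le hk1
  have hm0 : (0 : ℝ) < m := (sub_nonneg.2 (hmax x hx)).trans_lt hm
  have hkN : 0 < k := by exact_mod_cast hk0
  have hmN : 0 < m := by exact_mod_cast hm0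
  suffices hkx : z₀ + (k : ℝ) • (x - z₀) ∈ Ω by
    have := homothety_mem ho hc hz₀ hkx (div_pos ht hk0)
      ((div_le_one hk0).2 ((le_max_left _ _).trans hk))
    rwa [add_sub_cancel_left, smul_smul, div_mul_cancel₀ _ hk0.ne'] at this
  set S := AffineMap.homothety z₀ (k : ℝ)⁻¹ '' {x | (x, p) ∈ capPairs Ω ((k * m : ℕ) : ℝ)} with hS
  have hSsub : S ⊆ {x | (x, p) ∈ capPairs Ω (m : ℝ)} := by
    have := homothety_image_cap_subset (r := ((k * m : ℕ) : ℝ)) ho hc hp hz₀ hmax (inv_pos.2 hk0)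
      (inv_le_one_of_one_le₀ hk1)
    rwa [Nat.cast_mul, inv_mul_cancel_left₀ hk0.ne', ← Nat.cast_mul] at this
  have hSvol : volume S = capVolume Ω m p := by
    rw [hS, capVolume_homothety_image _ _ _ _ (inv_pos.2 hk0), hvol _ (Nat.mul_pos hkN hmN),
      hvol m hmN, ← mul_assoc, ← ENNReal.ofReal_mul (by positivity), Nat.cast_mul, mul_pow,
      ← mul_assoc, ← mul_pow, inv_mul_cancel₀ hk0.ne', one_pow, one_mul]
  set H : (Fin n → ℝ) → (Fin n → ℝ) := fun y => z₀ + (k : ℝ) • (y - z₀) with hH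
  have hHc : Continuous H := by fun_prop
  have hHS : ∀ y ∈ S, H y ∈ Ω := by
    rintro _ ⟨y, hy, rfl⟩
    have : H (AffineMap.homothety z₀ (k : ℝ)⁻¹ y) = y := by
      simp [hH, AffineMap.homothety_apply, smul_smul, mul_inv_cancel₀ hk0.ne']
    rw [this]
    exact hy.1
  set O : Set (Fin n → ℝ) := Ω ∩ {y | p ⬝ᵥ z₀ < p ⬝ᵥ y + m}
  have hOo : IsOpen O := ho.inter (isOpen_lt (by fun_prop) (by fun_prop))
  have hxO : x ∈ O := ⟨hx, mem_ofPred.2 (by linarith)⟩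
  have hOcl : ∀ y ∈ O, H y ∈ closure Ω := by
    intro y hy
    by_contra hn
    have hWo : IsOpen (O ∩ H ⁻¹' (closure Ω)ᶜ) :=
      hOo.inter (isClosed_closure.isOpen_compl.preimage hHc)
    have hpos := hWo.measure_pos volume ⟨y, hy, hn⟩
    have hdisj : Disjoint S (O ∩ H ⁻¹' (closure Ω)ᶜ) :=
      disjoint_left.2 fun y hyS hyW => hyW.2 (subset_closure (hHS y hyS))
    have hle : volume (S ∪ (O ∩ H ⁻¹' (closure Ω)ᶜ)) ≤ volume S := by
      rw [hSvol]
      refine measure_mono (union_subset hSsub fun y hy => ?_)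
      exact (mem_capPairs_iff hp hz₀ hmax).2 ⟨hy.1.1, hy.1.2.le⟩
    rw [measure_union hdisj hWo.measurableSet] at hle
    have hfin : volume S ≠ ∞ := hSvol ▸ (capVolume_lt_top hp _).ne
    exact (ENNReal.lt_add_right hfin hpos.ne').not_ge hle
  have hHO : IsOpen (H '' O) := by
    have : H = (Homeomorph.addLeft z₀) ∘ (Homeomorph.smulOfNeZero (k : ℝ) hk0.ne') ∘
        (Homeomorph.subRight z₀) := by
      ext y; simp [hH]
    rw [this]
    exact ((Homeomorph.addLeft z₀).isOpenMap.comp ((Homeomorph.smulOfNeZero _ hk0.ne').isOpenMap.comp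
      (Homeomorph.subRight z₀).isOpenMap)) _ hOo
  have hint : H x ∈ interior (closure Ω) :=
    interior_maximal (by rintro _ ⟨y, hy, rfl⟩; exact hOcl y hy) hHO ⟨x, hxO, rfl⟩
  rwa [hc.interior_closure_eq_interior_of_nonempty_interior (by rwa [ho.interior_eq]),
    ho.interior_eq] at hint

/-! ### Affine actions and their dual linear actions -/

theorem map_affine_volume {n : ℕ} {A : Matrix (Fin n) (Fin n) ℝ} (hA : A.det ≠ 0)
    (b : Fin n → ℝ) : Measure.map (fun x => A *ᵥ x + b) (volume : Measure (Fin n → ℝ))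
      = ENNReal.ofReal |A.det⁻¹| • volume := by
  have h : (fun x => A *ᵥ x + b) = (fun x => x + b) ∘ (toLin' A) := rfl
  rw [h, ← Measure.map_map (measurable_add_const b)
    (toLin' A).continuous_of_finiteDimensional.measurable,
    Real.map_matrix_volume_pi_eq_smul_volume_pi hA, Measure.map_smul, map_add_right_eq_self]

theorem map_vecMul_volume {n : ℕ} {A : Matrix (Fin n) (Fin n) ℝ} (hA : A.det ≠ 0) :
    Measure.map (fun p => p ᵥ* A) (volume : Measure (Fin n → ℝ))
      = ENNReal.ofReal |A.det⁻¹| • volume := by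
  have h : (fun p : Fin n → ℝ => p ᵥ* A) = fun p => Aᵀ *ᵥ p + 0 := by
    ext p
    rw [mulVec_transpose, add_zero]
  rw [h, map_affine_volume (by rwa [det_transpose]), det_transpose]

/-- A representation `G → Aff(ℝⁿ)`, given by its linear part and its translation part. -/
structure AffineRep (G : Type*) [Group G] (n : ℕ) where
  /-- The linear part. -/
  lin : G →* Matrix (Fin n) (Fin n) ℝ
  /-- The translation part. -/
  trans : G → Fin n → ℝ
  trans_mul : ∀ g h, trans (g * h) = lin g *ᵥ trans h + trans g

namespace AffineRep

variable {G : Type*} [Group G] {n : ℕ}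

/-- The affine action on points. -/
def act (ρ : AffineRep G n) (g : G) (x : Fin n → ℝ) : Fin n → ℝ := ρ.lin g *ᵥ x + ρ.trans g

/-- The dual linear action on linear forms. -/
def dual (ρ : AffineRep G n) (g : G) (p : Fin n → ℝ) : Fin n → ℝ := p ᵥ* ρ.lin g⁻¹

theorem lin_mul_inv (ρ : AffineRep G n) (g : G) : ρ.lin g * ρ.lin g⁻¹ = 1 := by
  rw [← map_mul, mul_inv_cancel, map_one]

theorem lin_inv_mul (ρ : AffineRep G n) (g : G) : ρ.lin g⁻¹ * ρ.lin g = 1 := by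
  rw [← map_mul, inv_mul_cancel, map_one]

theorem det_mul_det_inv (ρ : AffineRep G n) (g : G) : (ρ.lin g).det * (ρ.lin g⁻¹).det = 1 := by
  rw [← det_mul, lin_mul_inv, det_one]

theorem det_ne_zero (ρ : AffineRep G n) (g : G) : (ρ.lin g).det ≠ 0 :=
  left_ne_zero_of_mul_eq_one (ρ.det_mul_det_inv g)

theorem act_mul (ρ : AffineRep G n) (g h : G) (x : Fin n → ℝ) :
    ρ.act (g * h) x = ρ.act g (ρ.act h x) := by
  simp only [act, map_mul, ρ.trans_mul, mulVec_add, mulVec_mulVec, add_assoc]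

theorem act_one (ρ : AffineRep G n) (x : Fin n → ℝ) : ρ.act 1 x = x := by
  have h := ρ.trans_mul 1 1
  rw [mul_one, map_one, one_mulVec, left_eq_add] at h
  rw [act, map_one, one_mulVec, h, add_zero]

theorem act_inv_act (ρ : AffineRep G n) (g : G) (x : Fin n → ℝ) : ρ.act g⁻¹ (ρ.act g x) = x := by
  rw [← act_mul, inv_mul_cancel, act_one]

theorem dual_inv_dual (ρ : AffineRep G n) (g : G) (p : Fin n → ℝ) :
    ρ.dual g⁻¹ (ρ.dual g p) = p := by
  rw [dual, dual, vecMul_vecMul, inv_inv, lin_inv_mul, vecMul_one]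

theorem dual_dotProduct_act (ρ : AffineRep G n) (g : G) (p x : Fin n → ℝ) :
    ρ.dual g p ⬝ᵥ ρ.act g x = p ⬝ᵥ x + ρ.dual g p ⬝ᵥ ρ.trans g := by
  rw [act, dotProduct_add, dual, dotProduct_mulVec, vecMul_vecMul, lin_inv_mul, vecMul_one]

theorem continuous_act (ρ : AffineRep G n) (g : G) : Continuous (ρ.act g) := by
  unfold act; fun_prop

theorem continuous_dual (ρ : AffineRep G n) (g : G) : Continuous (ρ.dual g) := by
  unfold dual; fun_prop

theorem map_act_volume (ρ : AffineRep G n) (g : G) :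
    Measure.map (ρ.act g) volume = ENNReal.ofReal |(ρ.lin g).det⁻¹| • volume :=
  map_affine_volume (ρ.det_ne_zero g) _

theorem map_dual_volume (ρ : AffineRep G n) (g : G) :
    Measure.map (ρ.dual g) volume = ENNReal.ofReal |(ρ.lin g⁻¹).det⁻¹| • volume :=
  map_vecMul_volume (ρ.det_ne_zero g⁻¹)

/-- The product of the affine action and the dual action preserves volume. -/
theorem measurePreserving_prodMap (ρ : AffineRep G n) (g : G) :
    MeasurePreserving (Prod.map (ρ.act g) (ρ.dual g))
      ((volume : Measure (Fin n → ℝ)).prod (volume : Measure (Fin n → ℝ)))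
      ((volume : Measure (Fin n → ℝ)).prod (volume : Measure (Fin n → ℝ))) := by
  refine ⟨(ρ.continuous_act g).measurable.prodMap (ρ.continuous_dual g).measurable, ?_⟩
  rw [← Measure.map_prod_map _ _ (ρ.continuous_act g).measurable (ρ.continuous_dual g).measurable,
    map_act_volume, map_dual_volume, Measure.prod_smul_left, Measure.prod_smul_right, smul_smul,
    ← ENNReal.ofReal_mul (abs_nonneg _), ← abs_mul, ← mul_inv, det_mul_det_inv, inv_one, abs_one,
    ENNReal.ofReal_one, one_smul]

theorem dual_mem_boundedForms (ρ : AffineRep G n) {Ω : Set (Fin n → ℝ)}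
    (hΩ : ∀ g, ∀ x ∈ Ω, ρ.act g x ∈ Ω) (g : G) {p : Fin n → ℝ} (hp : p ∈ boundedForms Ω) :
    ρ.dual g p ∈ boundedForms Ω := by
  have ho : IsOpen (ρ.dual g⁻¹ ⁻¹' boundedForms Ω) :=
    (isOpen_boundedForms Ω).preimage (ρ.continuous_dual _)
  refine interior_maximal (fun q hq => ?_) ho (by rwa [mem_preimage, dual_inv_dual])
  obtain ⟨C, hC⟩ := interior_subset hq
  refine ⟨C - ρ.dual g⁻¹ q ⬝ᵥ ρ.trans g⁻¹, fun z hz => ?_⟩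
  have h1 := hC _ (hΩ g⁻¹ z hz)
  have h2 := ρ.dual_dotProduct_act g⁻¹ q z
  linarith

theorem prodMap_mem_capPairs (ρ : AffineRep G n) {Ω : Set (Fin n → ℝ)}
    (hΩ : ∀ g, ∀ x ∈ Ω, ρ.act g x ∈ Ω) {r : ℝ} (g : G) {q : (Fin n → ℝ) × (Fin n → ℝ)}
    (hq : q ∈ capPairs Ω r) : Prod.map (ρ.act g) (ρ.dual g) q ∈ capPairs Ω r := by
  refine ⟨hΩ g _ hq.1, ρ.dual_mem_boundedForms hΩ g hq.2.1, fun z hz => ?_⟩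
  have h1 := hq.2.2 _ (hΩ g⁻¹ z hz)
  have h2 := ρ.dual_dotProduct_act g q.2 (ρ.act g⁻¹ z)
  have h3 := ρ.dual_dotProduct_act g q.2 q.1
  rw [← act_mul, mul_inv_cancel, act_one] at h2
  simp only [Prod.map_fst, Prod.map_snd]
  linarith

theorem prodMap_inv (ρ : AffineRep G n) (g : G) (q : (Fin n → ℝ) × (Fin n → ℝ)) :
    Prod.map (ρ.act g⁻¹) (ρ.dual g⁻¹) (Prod.map (ρ.act g) (ρ.dual g) q) = q := by
  simp only [Prod.map, act_inv_act, dual_inv_dual]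

theorem prodMap_mem_capPairs_iff (ρ : AffineRep G n) {Ω : Set (Fin n → ℝ)}
    (hΩ : ∀ g, ∀ x ∈ Ω, ρ.act g x ∈ Ω) {r : ℝ} (g : G) (q : (Fin n → ℝ) × (Fin n → ℝ)) :
    Prod.map (ρ.act g) (ρ.dual g) q ∈ capPairs Ω r ↔ q ∈ capPairs Ω r := by
  refine ⟨fun h => ?_, ρ.prodMap_mem_capPairs hΩ g⟩
  rw [← ρ.prodMap_inv g q]
  exact ρ.prodMap_mem_capPairs hΩ g⁻¹ h

end AffineRep

/-! ### Weights -/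

/-- The indicator of `K`, normalized to have sum `1` over every orbit meeting `K`. -/
def orbitWeight {G : Type*} [Group G] {n : ℕ} (ρ : AffineRep G n) (K : Set (Fin n → ℝ))
    (x : Fin n → ℝ) : ℝ≥0∞ :=
  K.indicator 1 x / ∑' g, K.indicator 1 (ρ.act g x)

/-- The `w`-mass of the cap of depth one cut out by `p`. -/
def capMass {n : ℕ} (Ω : Set (Fin n → ℝ)) (w : (Fin n → ℝ) → ℝ≥0∞) (p : Fin n → ℝ) : ℝ≥0∞ :=
  ∫⁻ x, (capPairs Ω 1).indicator (fun q => w q.1) (x, p)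

theorem measurable_capMass {n : ℕ} {Ω : Set (Fin n → ℝ)} (hΩ : IsOpen Ω)
    {w : (Fin n → ℝ) → ℝ≥0∞} (hw : Measurable w) : Measurable (capMass Ω w) :=
  ((hw.comp measurable_fst).indicator (measurableSet_capPairs hΩ 1)).lintegral_prod_left'

theorem capMass_one {n : ℕ} {Ω : Set (Fin n → ℝ)} (hΩ : IsOpen Ω) (p : Fin n → ℝ) :
    capMass Ω (fun _ => 1) p = capVolume Ω 1 p := by
  have h : MeasurableSet {x | (x, p) ∈ capPairs Ω 1} :=
    measurable_prodMk_right (measurableSet_capPairs hΩ 1)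
  rw [capVolume, ← setLIntegral_one, ← lintegral_indicator h]
  rfl

theorem capMass_comp_act {G : Type*} [Group G] {n : ℕ} (ρ : AffineRep G n)
    {Ω : Set (Fin n → ℝ)} (ho : IsOpen Ω) (hΩ : ∀ g, ∀ x ∈ Ω, ρ.act g x ∈ Ω)
    {w : (Fin n → ℝ) → ℝ≥0∞} (hw : Measurable w) (g : G) (p : Fin n → ℝ) :
    capMass Ω (fun x => w (ρ.act g x)) p
      = ENNReal.ofReal |(ρ.lin g).det⁻¹| * capMass Ω w (ρ.dual g p) := by
  have hm : Measurable fun x => (capPairs Ω 1).indicator (fun q => w q.1) (x, ρ.dual g p) :=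
    ((hw.comp measurable_fst).indicator (measurableSet_capPairs ho 1)).comp measurable_prodMk_right
  rw [capMass, capMass, ← smul_eq_mul, ← lintegral_smul_measure, ← ρ.map_act_volume,
    lintegral_map hm (ρ.continuous_act g).measurable]
  refine lintegral_congr fun x => ?_
  have hiff := ρ.prodMap_mem_capPairs_iff hΩ (r := 1) g (x, p)
  rw [Prod.map_apply] at hiff
  by_cases hx : (x, p) ∈ capPairs Ω 1
  · rw [indicator_of_mem hx, indicator_of_mem (hiff.2 hx)]
  · rw [indicator_of_notMem hx, indicator_of_notMem (fun h => hx (hiff.1 h))]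

/-- The proportion of the `w`-mass in the caps is a weight on the space of linear forms. -/
theorem tsum_capMass_div_capVolume {G : Type*} [Group G] [Countable G] {n : ℕ}
    (ρ : AffineRep G n) {Ω : Set (Fin n → ℝ)} (hne : Ω.Nonempty) (ho : IsOpen Ω)
    (hΩ : ∀ g, ∀ x ∈ Ω, ρ.act g x ∈ Ω)
    {w : (Fin n → ℝ) → ℝ≥0∞} (hw : Measurable w) (hw1 : ∀ x ∈ Ω, ∑' g, w (ρ.act g x) = 1)
    {p : Fin n → ℝ} (hp : p ∈ boundedForms Ω) :
    ∑' g, capMass Ω w (ρ.dual g p) / capVolume Ω 1 (ρ.dual g p) = 1 := by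
  have hterm : ∀ g, capMass Ω w (ρ.dual g p) / capVolume Ω 1 (ρ.dual g p)
      = capMass Ω (fun x => w (ρ.act g x)) p / capVolume Ω 1 p := by
    intro g
    have hV := capMass_comp_act ρ ho hΩ (w := fun _ => 1) measurable_const g p
    rw [capMass_one ho, capMass_one ho] at hV
    rw [capMass_comp_act ρ ho hΩ hw, hV, ENNReal.mul_div_mul_left _ _ _ ENNReal.ofReal_ne_top]
    rw [Ne, ENNReal.ofReal_eq_zero, not_le]
    exact abs_pos.2 (inv_ne_zero (ρ.det_ne_zero g))
  have hsum : ∑' g, capMass Ω (fun x => w (ρ.act g x)) p = capVolume Ω 1 p := by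
    rw [← capMass_one ho]
    simp only [capMass]
    rw [← lintegral_tsum]
    · refine lintegral_congr fun x => ?_
      by_cases hx : (x, p) ∈ capPairs Ω 1
      · simp only [indicator_of_mem hx, hw1 x hx.1]
      · simp only [indicator_of_notMem hx, tsum_zero]
    · intro g
      exact ((((hw.comp (ρ.continuous_act g).measurable).comp measurable_fst).indicator
        (measurableSet_capPairs ho 1)).comp measurable_prodMk_right).aemeasurable
  simp only [hterm, div_eq_mul_inv, ENNReal.tsum_mul_right, hsum]
  exact ENNReal.mul_inv_cancel (capVolume_pos hne ho hp one_pos).ne' (capVolume_lt_top hp 1).ne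

theorem measurable_orbitWeight {G : Type*} [Group G] [Countable G] {n : ℕ} (ρ : AffineRep G n)
    {K : Set (Fin n → ℝ)} (hK : MeasurableSet K) : Measurable (orbitWeight ρ K) := by
  have h : Measurable (K.indicator (1 : (Fin n → ℝ) → ℝ≥0∞)) := measurable_one.indicator hK
  exact h.div (Measurable.tsum fun g => h.comp (ρ.continuous_act g).measurable)

theorem tsum_orbitWeight {G : Type*} [Group G] {n : ℕ} (ρ : AffineRep G n)
    {K : Set (Fin n → ℝ)} {x : Fin n → ℝ} (hcov : ∃ g, ρ.act g x ∈ K)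
    (hfin : {g | ρ.act g x ∈ K}.Finite) : ∑' g, orbitWeight ρ K (ρ.act g x) = 1 := by
  set N : ℝ≥0∞ := ∑' g, K.indicator 1 (ρ.act g x)
  have hinv : ∀ g, ∑' h, K.indicator (1 : (Fin n → ℝ) → ℝ≥0∞) (ρ.act h (ρ.act g x)) = N := by
    intro g
    simp only [← ρ.act_mul]
    exact (Equiv.mulRight g).tsum_eq (fun h => K.indicator (1 : (Fin n → ℝ) → ℝ≥0∞) (ρ.act h x))
  simp only [orbitWeight, hinv, div_eq_mul_inv, ENNReal.tsum_mul_right]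
  refine ENNReal.mul_inv_cancel ?_ ?_
  · obtain ⟨g, hg⟩ := hcov
    intro h0
    have := ENNReal.tsum_eq_zero.1 h0 g
    rw [indicator_of_mem hg] at this
    exact one_ne_zero this
  · have hzero : ∀ g ∉ hfin.toFinset,
        K.indicator (1 : (Fin n → ℝ) → ℝ≥0∞) (ρ.act g x) = 0 := fun g hg =>
      indicator_of_notMem (s := K) (fun h : ρ.act g x ∈ K => hg (hfin.mem_toFinset.2 h)) _
    rw [tsum_eq_sum hzero]
    refine ENNReal.sum_ne_top.2 fun g _ => ?_
    by_cases hg : ρ.act g x ∈ K <;> simp [hg]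

theorem orbitWeight_le {G : Type*} [Group G] {n : ℕ} (ρ : AffineRep G n)
    (K : Set (Fin n → ℝ)) (x : Fin n → ℝ) : orbitWeight ρ K x ≤ K.indicator 1 x := by
  by_cases hx : x ∈ K
  · rw [orbitWeight, indicator_of_mem hx]
    refine ENNReal.div_le_of_le_mul ?_
    rw [Pi.one_apply, one_mul]
    have := ENNReal.le_tsum (f := fun g => K.indicator (1 : (Fin n → ℝ) → ℝ≥0∞) (ρ.act g x)) 1
    rwa [ρ.act_one, indicator_of_mem hx] at this
  · simp [orbitWeight, hx]

/-! ### Polar fibres -/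

/-- The volume of the set of linear forms whose cap of depth `r` contains `x`. -/
theorem volume_polar_natCast {n : ℕ} (Ω : Set (Fin n → ℝ)) (x : Fin n → ℝ) {m : ℕ}
    (hm : 0 < m) : volume {p | (x, p) ∈ capPairs Ω m}
      = ENNReal.ofReal ((m : ℝ) ^ n) * volume {p | (x, p) ∈ capPairs Ω 1} := by
  have hm0 : (0 : ℝ) < m := by exact_mod_cast hm
  have hsmul : ∀ {s : ℝ}, 0 < s → ∀ {p}, p ∈ boundedForms Ω → s • p ∈ boundedForms Ω := by
    intro s hs p hp
    have hs' := hs.ne'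
    have ho : IsOpen ((fun q : Fin n → ℝ => s⁻¹ • q) ⁻¹' boundedForms Ω) :=
      (isOpen_boundedForms Ω).preimage (by fun_prop)
    refine interior_maximal (fun q hq => ?_) ho
      (by simpa only [mem_preimage, smul_smul, inv_mul_cancel₀ hs', one_smul] using hp)
    obtain ⟨C, hC⟩ := interior_subset hq
    refine ⟨s * C, fun z hz => ?_⟩
    have := mul_le_mul_of_nonneg_left (hC z hz) hs.le
    rwa [smul_dotProduct, smul_eq_mul, mul_inv_cancel_left₀ hs'] at this
  have hcap : ∀ {s r : ℝ}, 0 < s → ∀ {p}, (x, p) ∈ capPairs Ω r →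
      (x, s • p) ∈ capPairs Ω (s * r) := by
    intro s r hs p hp
    refine ⟨hp.1, hsmul hs hp.2.1, fun z hz => ?_⟩
    have := mul_le_mul_of_nonneg_left (hp.2.2 z hz) hs.le
    simp only [smul_dotProduct, smul_eq_mul] at this ⊢
    linarith
  have hset : {p | (x, p) ∈ capPairs Ω (m : ℝ)} = (m : ℝ) • {p | (x, p) ∈ capPairs Ω 1} := by
    ext p
    rw [mem_smul_set_iff_inv_smul_mem₀ hm0.ne']
    refine ⟨fun h => ?_, fun h => ?_⟩
    · have := hcap (inv_pos.2 hm0) h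
      rwa [inv_mul_cancel₀ hm0.ne'] at this
    · have := hcap hm0 h
      rwa [smul_inv_smul₀ hm0.ne', mul_one] at this
  rw [hset, Measure.addHaar_smul, Module.finrank_fin_fun, abs_of_pos (by positivity)]

/-- The polar fibres over a compact subset of `Ω` have bounded volume. -/
theorem exists_volume_polar_le {n : ℕ} {Ω K : Set (Fin n → ℝ)} (ho : IsOpen Ω)
    (hK : IsCompact K) (hKΩ : K ⊆ Ω) :
    ∃ c : ℝ≥0∞, c ≠ ∞ ∧ ∀ x ∈ K, volume {p | (x, p) ∈ capPairs Ω 1} ≤ c := by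
  obtain ⟨ε, hε, hball⟩ := hK.exists_thickening_subset_open ho hKΩ
  refine ⟨volume (Icc (fun _ : Fin n => -(ε / 2)⁻¹) (fun _ => (ε / 2)⁻¹)),
    isCompact_Icc.measure_lt_top.ne, fun x hx => measure_mono fun p hp => ?_⟩
  have hmem : ∀ i (s : ℝ), |s| < ε → p i * s ≤ 1 := by
    intro i s hs
    have hxs : x + Pi.single i s ∈ Ω := by
      refine hball (Metric.mem_thickening_iff.2 ⟨x, hx, ?_⟩)
      rw [dist_eq_norm, add_sub_cancel_left, Pi.norm_single]
      exact hs
    have := hp.2.2 _ hxs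
    simp only [dotProduct_add, dotProduct_single] at this
    linarith
  have hε2 : |ε / 2| < ε := by rw [abs_of_pos (by positivity)]; linarith
  refine ⟨fun i => ?_, fun i => ?_⟩
  · have := hmem i (-(ε / 2)) (by rwa [abs_neg])
    simp only
    rw [neg_le, ← one_div, le_div_iff₀ (by positivity)]
    linarith
  · have := hmem i (ε / 2) hε2
    simp only
    rwa [← one_div, le_div_iff₀ (by positivity)]

/-! ### The main argument -/

/-- A properly convex domain with a cocompact affine action, finite on orbits, is a cone. -/
theorem AffineRep.isCone {G : Type*} [Group G] [Countable G] {n : ℕ} (ρ : AffineRep G n)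
    {Ω K : Set (Fin n → ℝ)} (hprop : IsProperlyConvexDomain n Ω)
    (hΩ : ∀ g, ∀ x ∈ Ω, ρ.act g x ∈ Ω) (hK : IsCompact K) (hKΩ : K ⊆ Ω)
    (hcov : ∀ x ∈ Ω, ∃ g, ρ.act g x ∈ K) (hfin : ∀ x ∈ Ω, {g | ρ.act g x ∈ K}.Finite) :
    IsCone n Ω := by
  obtain ⟨⟨hne, ho, hc⟩, -⟩ := id hprop
  set w := orbitWeight ρ K
  have hw : Measurable w := measurable_orbitWeight ρ hK.measurableSet
  have hw1 : ∀ x ∈ Ω, ∑' g, w (ρ.act g x) = 1 := fun x hx =>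
    tsum_orbitWeight ρ (hcov x hx) (hfin x hx)
  set χ : (Fin n → ℝ) → ℝ≥0∞ := fun p => capMass Ω w p / capVolume Ω 1 p
  have hχ : Measurable χ := (measurable_capMass ho hw).div (measurable_capVolume ho 1)
  have hχ1 : ∀ p ∈ boundedForms Ω, ∑' g, χ (ρ.dual g p) = 1 := fun p hp =>
    tsum_capMass_div_capVolume ρ hne ho hΩ hw hw1 hp
  have hmass : ∀ r : ℝ, ∫⁻ p, χ p * capVolume Ω r p
      = ∫⁻ x, w x * volume {p | (x, p) ∈ capPairs Ω r} := by
    intro r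
    have hU := measurableSet_capPairs ho r
    rw [← setLIntegral_prod_fst hU hw]
    refine (setLIntegral_prod_snd hU hχ).symm.trans ?_
    exact setLIntegral_eq_of_tsum_orbit_eq_one ρ.measurePreserving_prodMap
      ρ.prodMap_inv hU (ρ.prodMap_mem_capPairs_iff hΩ) (hχ.comp measurable_snd)
      (hw.comp measurable_fst) (fun q hq => hχ1 _ hq.2.1) (fun q hq => hw1 _ hq.1)
  have hfin1 : ∫⁻ p, χ p * capVolume Ω 1 p ≠ ∞ := by
    obtain ⟨c, hc, hle⟩ := exists_volume_polar_le ho hK hKΩ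
    rw [hmass]
    refine ne_top_of_le_ne_top
      (ENNReal.mul_ne_top hc (hK.measure_lt_top (μ := volume)).ne) ?_
    rw [← setLIntegral_const, ← lintegral_indicator hK.measurableSet]
    refine lintegral_mono fun x => ?_
    by_cases hx : x ∈ K
    · have := orbitWeight_le ρ K x
      rw [indicator_of_mem hx] at this ⊢
      exact (mul_le_mul' this (hle x hx)).trans (one_mul c).le
    · have := orbitWeight_le ρ K x
      rw [indicator_of_notMem hx, nonpos_iff_eq_zero] at this
      simp [w, this]
  have hscale : ∀ m : ℕ, 0 < m → ∫⁻ p, χ p * capVolume Ω m p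
      = ∫⁻ p, χ p * (ENNReal.ofReal ((m : ℝ) ^ n) * capVolume Ω 1 p) := by
    intro m hm
    simp only [hmass, volume_polar_natCast Ω _ hm, mul_left_comm _ (ENNReal.ofReal _)]
    rw [lintegral_const_mul' _ _ ENNReal.ofReal_ne_top,
      lintegral_const_mul' _ _ ENNReal.ofReal_ne_top, hmass]
  have hae : ∀ᵐ p, ∀ m : ℕ, 0 < m → χ p * capVolume Ω m p
      = χ p * (ENNReal.ofReal ((m : ℝ) ^ n) * capVolume Ω 1 p) := by
    rw [ae_all_iff]
    intro m
    by_cases hm : 0 < m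
    · have hle : ∀ p, χ p * capVolume Ω m p
          ≤ χ p * (ENNReal.ofReal ((m : ℝ) ^ n) * capVolume Ω 1 p) := by
        intro p
        by_cases hp : p ∈ boundedForms Ω
        · gcongr
          exact capVolume_natCast_mul_le hne ho hc hp hm
        · have : capVolume Ω m p = 0 := by
            have h0 : {x | (x, p) ∈ capPairs Ω m} = ∅ :=
              eq_empty_of_forall_notMem fun x hx => hp hx.2.1
            rw [capVolume, h0, measure_empty]
          simp [this]
      have hfinm : ∫⁻ p, χ p * capVolume Ω m p ≠ ∞ := by
        rw [hscale m hm]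
        simp only [mul_left_comm _ (ENNReal.ofReal _)]
        rw [lintegral_const_mul' _ _ ENNReal.ofReal_ne_top]
        exact ENNReal.mul_ne_top ENNReal.ofReal_ne_top hfin1
      filter_upwards [ae_eq_of_ae_le_of_lintegral_le (ae_of_all _ hle) hfinm
        (hχ.mul ((measurable_capVolume ho 1).const_mul _)).aemeasurable (hscale m hm).ge]
        with p hp _ using hp
    · exact ae_of_all _ fun p h => absurd h hm
  have hae' : ∀ᵐ p, ∀ g, ∀ m : ℕ, 0 < m → χ (ρ.dual g p) * capVolume Ω m (ρ.dual g p)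
      = χ (ρ.dual g p) * (ENNReal.ofReal ((m : ℝ) ^ n) * capVolume Ω 1 (ρ.dual g p)) := by
    rw [ae_all_iff]
    intro g
    have hq : Measure.QuasiMeasurePreserving (ρ.dual g) volume volume :=
      ⟨(ρ.continuous_dual g).measurable, by
        rw [map_dual_volume]; exact Measure.smul_absolutelyContinuous⟩
    exact hq.ae hae
  obtain ⟨p, hp, hgood⟩ : ∃ p ∈ boundedForms Ω, ∀ g, ∀ m : ℕ, 0 < m →
      χ (ρ.dual g p) * capVolume Ω m (ρ.dual g p)
      = χ (ρ.dual g p) * (ENNReal.ofReal ((m : ℝ) ^ n) * capVolume Ω 1 (ρ.dual g p)) := by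
    have hpos := (isOpen_boundedForms Ω).measure_pos volume (boundedForms_nonempty hprop)
    by_contra! hcon
    refine hpos.ne' (measure_mono_null (fun p hp => ?_) (ae_iff.1 hae'))
    obtain ⟨g, m, hm, hne⟩ := hcon p hp
    exact fun hgood => hne (hgood g m hm)
  obtain ⟨g, hg⟩ : ∃ g, χ (ρ.dual g p) ≠ 0 := by
    by_contra! h0
    have := hχ1 p hp
    simp [h0] at this
  have hg' : χ (ρ.dual g p) ≠ ∞ := by
    have h := ENNReal.le_tsum (f := fun g => χ (ρ.dual g p)) g
    rw [hχ1 p hp] at h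
    exact (h.trans_lt ENNReal.one_lt_top).ne
  refine isCone_of_capVolume_eq hne ho hc (ρ.dual_mem_boundedForms hΩ g hp) fun m hm => ?_
  exact (ENNReal.mul_right_inj hg hg').1 (hgood g m hm)

/-! ### Affine-form matrices -/

/-- The linear part of a matrix in affine form. -/
def linPart (n : ℕ) (g : GL (Fin (n + 1)) ℝ) : Matrix (Fin n) (Fin n) ℝ :=
  Matrix.of fun i j => g.val i.castSucc j.castSucc

/-- The translation part of a matrix in affine form. -/
def transPart (n : ℕ) (g : GL (Fin (n + 1)) ℝ) : Fin n → ℝ :=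
  fun i => g.val i.castSucc (Fin.last n)

/-- The affine representation of a group of matrices in affine form. -/
def affineRepOfSubgroup {n : ℕ} (Γ : Subgroup (GL (Fin (n + 1)) ℝ))
    (hΓ : ∀ g ∈ Γ, IsAffineForm n g) : AffineRep Γ n where
  lin :=
    { toFun := fun g => linPart n g
      map_one' := by
        ext i j
        simp [linPart, Matrix.one_apply]
      map_mul' := fun g h => by
        ext i j
        simp [linPart, Matrix.mul_apply, Fin.sum_univ_castSucc, (hΓ h h.2).1] }
  trans := fun g => transPart n g
  trans_mul := fun g h => by
    ext i
    simp [linPart, transPart, Matrix.mul_apply, mulVec, dotProduct, Fin.sum_univ_castSucc,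
      (hΓ h h.2).2]

theorem affineRepOfSubgroup_act {n : ℕ} (Γ : Subgroup (GL (Fin (n + 1)) ℝ))
    (hΓ : ∀ g ∈ Γ, IsAffineForm n g) (g : Γ) (x : Fin n → ℝ) :
    (affineRepOfSubgroup Γ hΓ).act g x = affAct n g x :=
  rfl

theorem countable_of_discrete_GL {n : ℕ} (Γ : Subgroup (GL (Fin (n + 1)) ℝ))
    [DiscreteTopology Γ] : Countable Γ := by
  have : SecondCountableTopology (Matrix (Fin (n + 1)) (Fin (n + 1)) ℝ) :=
    inferInstanceAs (SecondCountableTopology (Fin (n + 1) → Fin (n + 1) → ℝ))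
  have : SecondCountableTopology (Matrix (Fin (n + 1)) (Fin (n + 1)) ℝ)ᵐᵒᵖ :=
    MulOpposite.opHomeomorph.symm.isInducing.secondCountableTopology
  have : SecondCountableTopology (GL (Fin (n + 1)) ℝ) :=
    Units.isInducing_embedProduct.secondCountableTopology
  exact countable_of_Lindelof_of_discrete

/-- Vey: every divisible properly convex affine domain is a cone. -/
theorem divisible_properlyConvex_is_cone (n : ℕ) (Ω : Set (Fin n → ℝ))
    (h1 : IsProperlyConvexDomain n Ω)
    (Γ : Subgroup (GL (Fin (n + 1)) ℝ))
    (hΓ : (Γ : Set (GL (Fin (n + 1)) ℝ)) ⊆ AutSet n Ω)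
    (hdisc : DiscreteTopology Γ)
    (hfree : ActsFreely n Ω (Γ : Set (GL (Fin (n + 1)) ℝ)))
    (hpd : ActsProperlyDiscontinuously n Ω (Γ : Set (GL (Fin (n + 1)) ℝ)))
    (hcc : ActsCocompactly n Ω (Γ : Set (GL (Fin (n + 1)) ℝ))) :
    IsCone n Ω := by
  obtain ⟨K, hK, hKΩ, hcov⟩ := hcc
  have := countable_of_discrete_GL Γ
  set ρ := affineRepOfSubgroup Γ fun g hg => (hΓ hg).1
  refine ρ.isCone h1 (fun g x hx => ?_) hK hKΩ (fun x hx => ?_) (fun x hx => ?_)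
  · rw [← (hΓ g.2).2]
    exact ⟨x, hx, rfl⟩
  · rw [← hcov] at hx
    simp only [mem_iUnion] at hx
    obtain ⟨g, hg, y, hy, rfl⟩ := hx
    refine ⟨(⟨g, hg⟩ : Γ)⁻¹, ?_⟩
    rw [← affineRepOfSubgroup_act Γ (fun g hg => (hΓ hg).1) ⟨g, hg⟩, ρ.act_inv_act]
    exact hy
  · have h := hpd {x} K (singleton_subset_iff.2 hx) hKΩ isCompact_singleton hK
    refine (h.preimage Subtype.val_injective.injOn).subset fun g hg => ⟨g.2, ?_⟩
    exact ⟨affAct n g x, ⟨x, rfl, rfl⟩, hg⟩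
end
end
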